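/- Any entire solution u of −Δu = K₀ e^{2u} on ℝ² with constant K₀ > 0 and ∫_{ℝ²} e^{2u} dz < ∞ satisfies ∫_{ℝ²} K₀ e^{2u} dz = 4π, and u is obtained from the stereographic projection, i.e., u(z) = log(2λ/(√{K₀}(1 + λ²|z − z₀|²))) for some λ > 0, z₀ ∈ ℝ² (Chen–Li classification). -/

import Mathlib

open Real MeasureTheory

/-- The Euclidean plane `ℝ²`. -/
abbrev R2 := EuclideanSpace ℝ (Fin 2)

/-- The Laplacian of a function on `ℝ²`. -/
noncomputable def lap (u : R2 → ℝ) (z : R2) : ℝ :=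
  ∑ i : Fin 2,
    fderiv ℝ (fun w => fderiv ℝ u w (EuclideanSpace.single i 1)) z
      (EuclideanSpace.single i 1)

open scoped ContDiff Topology

/-! ### Partial derivatives in the plane -/

/-- The partial derivative `∂ᵢF` of a function on `ℝ²`. -/
noncomputable def pd (i : Fin 2) (F : R2 → ℝ) (z : R2) : ℝ :=
  fderiv ℝ F z (EuclideanSpace.single i 1)

section PartialDerivatives

variable {F G : R2 → ℝ}

lemma lap_eq_pd (F : R2 → ℝ) (z : R2) : lap F z = pd 0 (pd 0 F) z + pd 1 (pd 1 F) z := by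
  simp only [lap, Fin.sum_univ_two]
  rfl

lemma ContDiff.differentiable_infty (hF : ContDiff ℝ ∞ F) : Differentiable ℝ F :=
  hF.differentiable (by simp)

lemma ContDiff.pd (hF : ContDiff ℝ ∞ F) (i : Fin 2) : ContDiff ℝ ∞ (pd i F) :=
  (hF.fderiv_right (m := ∞) (by simp)).clm_apply contDiff_const

lemma ContDiff.lap (hF : ContDiff ℝ ∞ F) : ContDiff ℝ ∞ (lap F) := by
  rw [show _root_.lap F = fun z => _ from funext (lap_eq_pd F)]
  exact ((hF.pd 0).pd 0).add ((hF.pd 1).pd 1)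

lemma pd_add (hF : ContDiff ℝ ∞ F) (hG : ContDiff ℝ ∞ G) (i : Fin 2) :
    pd i (fun z => F z + G z) = fun z => pd i F z + pd i G z := by
  funext z
  simp only [pd]
  rw [fderiv_fun_add (hF.differentiable_infty z) (hG.differentiable_infty z)]
  rfl

lemma pd_sub (hF : ContDiff ℝ ∞ F) (hG : ContDiff ℝ ∞ G) (i : Fin 2) :
    pd i (fun z => F z - G z) = fun z => pd i F z - pd i G z := by
  funext z
  simp only [pd]
  rw [fderiv_fun_sub (hF.differentiable_infty z) (hG.differentiable_infty z)]
  rfl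

lemma pd_mul (hF : ContDiff ℝ ∞ F) (hG : ContDiff ℝ ∞ G) (i : Fin 2) :
    pd i (fun z => F z * G z) = fun z => F z * pd i G z + G z * pd i F z := by
  funext z
  simp only [pd]
  rw [fderiv_fun_mul (hF.differentiable_infty z) (hG.differentiable_infty z)]
  rfl

lemma pd_const_mul (hF : ContDiff ℝ ∞ F) (a : ℝ) (i : Fin 2) :
    pd i (fun z => a * F z) = fun z => a * pd i F z := by
  funext z
  simp only [pd]
  rw [fderiv_const_mul (hF.differentiable_infty z)]
  rfl

lemma pd_neg (F : R2 → ℝ) (i : Fin 2) : pd i (fun z => -F z) = fun z => -pd i F z := by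
  funext z
  simp only [pd]
  rw [fderiv_fun_neg]
  rfl

lemma pd_const (a : ℝ) (i : Fin 2) : pd i (fun _ => a) = fun _ => 0 := by
  funext z
  simp [pd]

lemma pd_exp (hF : ContDiff ℝ ∞ F) (i : Fin 2) :
    pd i (fun z => exp (F z)) = fun z => exp (F z) * pd i F z := by
  funext z
  simp only [pd]
  rw [fderiv_exp (hF.differentiable_infty z)]
  rfl

lemma pd_coord (i j : Fin 2) : pd i (fun z => z j) = fun _ => if i = j then 1 else 0 := by
  funext z
  have : fderiv ℝ (fun z : R2 => z j) z = EuclideanSpace.proj j :=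
    (EuclideanSpace.proj j : R2 →L[ℝ] ℝ).hasFDerivAt.fderiv
  simp [pd, this, eq_comm]

lemma contDiff_coord (j : Fin 2) : ContDiff ℝ ∞ (fun z : R2 => z j) :=
  (EuclideanSpace.proj j : R2 →L[ℝ] ℝ).contDiff

lemma pd_pd_eq_fderiv_fderiv (hF : ContDiff ℝ ∞ F) (i j : Fin 2) (z : R2) :
    pd i (pd j F) z = fderiv ℝ (fderiv ℝ F) z (EuclideanSpace.single i 1)
      (EuclideanSpace.single j 1) := by
  have hd : DifferentiableAt ℝ (fderiv ℝ F) z :=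
    (hF.fderiv_right (m := ∞) (by simp)).differentiable (by simp) z
  change fderiv ℝ (fun w => fderiv ℝ F w (EuclideanSpace.single j 1)) z _ = _
  rw [fderiv_clm_apply hd (differentiableAt_const _)]
  simp

lemma pd_comm (hF : ContDiff ℝ ∞ F) (i j : Fin 2) : pd i (pd j F) = pd j (pd i F) := by
  funext z
  rw [pd_pd_eq_fderiv_fderiv hF, pd_pd_eq_fderiv_fderiv hF]
  exact (hF.contDiffAt.isSymmSndFDerivAt (by
    rw [minSmoothness_of_isRCLikeNormedField]
    exact WithTop.coe_le_coe.2 le_top)).eq _ _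

lemma fderiv_eq_pd (F : R2 → ℝ) (z v : R2) :
    fderiv ℝ F z v = v 0 * pd 0 F z + v 1 * pd 1 F z := by
  have hv : v = v 0 • EuclideanSpace.single 0 (1 : ℝ) + v 1 • EuclideanSpace.single 1 (1 : ℝ) := by
    ext i
    fin_cases i <;> simp
  conv_lhs => rw [hv]
  simp [pd]

/-- A smooth function with vanishing partial derivatives is constant. -/
lemma eq_const_of_pd_eq_zero (hF : ContDiff ℝ ∞ F) (h : ∀ i z, pd i F z = 0) (z : R2) :
    F z = F 0 := by
  refine is_const_of_fderiv_eq_zero hF.differentiable_infty (fun w => ?_) z 0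
  ext v
  simp [fderiv_eq_pd, h]

end PartialDerivatives

/-! ### Circle integrals and the divergence theorem -/

/-- The point with polar coordinates `(r, θ)` around `c`. -/
noncomputable def circ (c : R2) (r θ : ℝ) : R2 := c + r • !₂[cos θ, sin θ]

/-- The integral of `F` over the circle of radius `r` around `c` in the angular variable. -/
noncomputable def circInt (F : R2 → ℝ) (c : R2) (r : ℝ) : ℝ := ∫ θ in -π..π, F (circ c r θ)

/-- The angular integral of the outward normal component of the vector field `(P, Q)`. -/
noncomputable def circFlux (P Q : R2 → ℝ) (c : R2) (r : ℝ) : ℝ :=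
  ∫ θ in -π..π, (cos θ * P (circ c r θ) + sin θ * Q (circ c r θ))

section Circle

variable {F P Q : R2 → ℝ}

lemma norm_cos_sin (θ : ℝ) : ‖(!₂[cos θ, sin θ] : R2)‖ = 1 := by
  simp [EuclideanSpace.norm_eq]

lemma dist_circ (c : R2) (r θ : ℝ) : dist (circ c r θ) c = |r| := by
  simp only [circ, dist_eq_norm, add_sub_cancel_left, norm_smul, norm_cos_sin, mul_one,
    norm_eq_abs]

@[fun_prop]
lemma continuous_circ {X : Type*} [TopologicalSpace X] {f g : X → ℝ} (hf : Continuous f)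
    (hg : Continuous g) (c : R2) : Continuous fun x => circ c (f x) (g x) := by
  unfold circ
  fun_prop

lemma continuous_comp_circ (hF : Continuous F) (c : R2) :
    Continuous fun p : ℝ × ℝ => F (circ c p.1 p.2) :=
  hF.comp (continuous_circ continuous_fst continuous_snd c)

lemma continuous_comp_circ_angle (hF : Continuous F) (c : R2) (r : ℝ) :
    Continuous fun θ => F (circ c r θ) :=
  (continuous_comp_circ hF c).comp (Continuous.prodMk_right r)

lemma hasDerivAt_circ_radius (c : R2) (r θ : ℝ) :
    HasDerivAt (fun r => circ c r θ) !₂[cos θ, sin θ] r := by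
  unfold circ
  simpa using ((hasDerivAt_id r).smul_const (!₂[cos θ, sin θ] : R2)).const_add c

lemma hasDerivAt_circ_angle (c : R2) (r θ : ℝ) :
    HasDerivAt (fun θ => circ c r θ) (r • !₂[-sin θ, cos θ]) θ := by
  unfold circ
  refine HasDerivAt.const_add c (HasDerivAt.const_smul r ?_)
  have h := ((hasDerivAt_cos θ).smul_const (EuclideanSpace.single 0 1 : R2)).fun_add
    ((hasDerivAt_sin θ).smul_const (EuclideanSpace.single 1 1 : R2))
  have hv : ∀ x y : ℝ, x • (EuclideanSpace.single 0 1 : R2) +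
      y • (EuclideanSpace.single 1 1 : R2) = !₂[x, y] := by
    intro x y
    ext i
    fin_cases i <;> simp
  simpa only [hv] using h

lemma hasDerivAt_comp_circ_radius (hF : ContDiff ℝ ∞ F) (c : R2) (r θ : ℝ) :
    HasDerivAt (fun r => F (circ c r θ))
      (cos θ * pd 0 F (circ c r θ) + sin θ * pd 1 F (circ c r θ)) r := by
  have h := (hF.differentiable_infty (circ c r θ)).hasFDerivAt.comp_hasDerivAt r
    (hasDerivAt_circ_radius c r θ)
  rw [fderiv_eq_pd] at h
  exact h

lemma hasDerivAt_comp_circ_angle (hF : ContDiff ℝ ∞ F) (c : R2) (r θ : ℝ) :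
    HasDerivAt (fun θ => F (circ c r θ))
      (r * (-sin θ * pd 0 F (circ c r θ) + cos θ * pd 1 F (circ c r θ))) θ := by
  have h := (hF.differentiable_infty (circ c r θ)).hasFDerivAt.comp_hasDerivAt θ
    (hasDerivAt_circ_angle c r θ)
  rw [fderiv_eq_pd] at h
  refine h.congr_deriv ?_
  simp only [PiLp.smul_apply, smul_eq_mul, Matrix.cons_val_zero, Matrix.cons_val_one]
  ring

/-- Differentiation under the integral sign for jointly continuous data. -/
lemma hasDerivAt_intervalIntegral_param {g g' : ℝ → ℝ → ℝ} {a b : ℝ}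
    (hg : Continuous fun p : ℝ × ℝ => g p.1 p.2) (hg' : Continuous fun p : ℝ × ℝ => g' p.1 p.2)
    (hd : ∀ r θ, HasDerivAt (fun r => g r θ) (g' r θ) r) (r : ℝ) :
    HasDerivAt (fun r => ∫ θ in a..b, g r θ) (∫ θ in a..b, g' r θ) r := by
  obtain ⟨C, hC⟩ := ((isCompact_closedBall r 1).prod (isCompact_uIcc (a := a)
    (b := b))).exists_bound_of_continuousOn hg'.continuousOn
  have hsec : ∀ r, Continuous (g r) := fun r => hg.comp (Continuous.prodMk_right r)
  have hsec' : ∀ r, Continuous (g' r) := fun r => hg'.comp (Continuous.prodMk_right r)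
  refine (intervalIntegral.hasDerivAt_integral_of_dominated_loc_of_deriv_le
    (bound := fun _ => C) (Metric.closedBall_mem_nhds r one_pos)
    (Filter.Eventually.of_forall fun x => (hsec x).aestronglyMeasurable)
    ((hsec r).intervalIntegrable _ _) (hsec' r).aestronglyMeasurable
    (Filter.Eventually.of_forall fun t ht x hx => ?_) intervalIntegrable_const
    (Filter.Eventually.of_forall fun t _ x _ => hd x t)).2
  exact hC (x, t) ⟨hx, Set.uIoc_subset_uIcc ht⟩

lemma continuous_circInt (hF : Continuous F) (c : R2) : Continuous (circInt F c) :=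
  intervalIntegral.continuous_parametric_intervalIntegral_of_continuous'
    (continuous_comp_circ hF c) _ _

lemma continuous_flux_integrand (hP : Continuous P) (hQ : Continuous Q) (c : R2) :
    Continuous fun p : ℝ × ℝ =>
      cos p.2 * P (circ c p.1 p.2) + sin p.2 * Q (circ c p.1 p.2) := by
  fun_prop

lemma continuous_circFlux (hP : Continuous P) (hQ : Continuous Q) (c : R2) :
    Continuous (circFlux P Q c) :=
  intervalIntegral.continuous_parametric_intervalIntegral_of_continuous'
    (continuous_flux_integrand hP hQ c) _ _

lemma circInt_zero (F : R2 → ℝ) (c : R2) : circInt F c 0 = 2 * π * F c := by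
  simp only [circInt, circ, zero_smul, add_zero, intervalIntegral.integral_const, smul_eq_mul]
  ring

lemma circInt_mono {F G : R2 → ℝ} (hF : Continuous F) (hG : Continuous G) {c : R2} {r : ℝ}
    (h : ∀ z, dist z c = |r| → F z ≤ G z) : circInt F c r ≤ circInt G c r :=
  intervalIntegral.integral_mono_on (by linarith [pi_pos])
    ((continuous_comp_circ_angle hF c r).intervalIntegrable _ _)
    ((continuous_comp_circ_angle hG c r).intervalIntegrable _ _)
    fun θ _ => h _ (dist_circ c r θ)

lemma circInt_const (a : ℝ) (c : R2) (r : ℝ) : circInt (fun _ => a) c r = 2 * π * a := by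
  simp only [circInt, intervalIntegral.integral_const, smul_eq_mul]
  ring

lemma circInt_nonneg (hF : ∀ z, 0 ≤ F z) (c : R2) (r : ℝ) : 0 ≤ circInt F c r :=
  intervalIntegral.integral_nonneg (by linarith [pi_pos]) fun _ _ => hF _

lemma hasDerivAt_circInt (hF : ContDiff ℝ ∞ F) (c : R2) (r : ℝ) :
    HasDerivAt (circInt F c) (circFlux (pd 0 F) (pd 1 F) c r) r :=
  hasDerivAt_intervalIntegral_param (continuous_comp_circ hF.continuous c)
    (continuous_flux_integrand (hF.pd 0).continuous (hF.pd 1).continuous c)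
    (fun r θ => hasDerivAt_comp_circ_radius hF c r θ) r

/-- The divergence theorem on discs, in differentiated form. -/
lemma hasDerivAt_mul_circFlux (hP : ContDiff ℝ ∞ P) (hQ : ContDiff ℝ ∞ Q) (c : R2) (r : ℝ) :
    HasDerivAt (fun r => r * circFlux P Q c r)
      (r * circInt (fun z => pd 0 P z + pd 1 Q z) c r) r := by
  have hc₀ := continuous_comp_circ (hP.pd 0).continuous c
  have hc₁ := continuous_comp_circ (hP.pd 1).continuous c
  have hc₂ := continuous_comp_circ (hQ.pd 0).continuous c
  have hc₃ := continuous_comp_circ (hQ.pd 1).continuous c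
  have hflux := continuous_flux_integrand hP.continuous hQ.continuous c
  have hrad : HasDerivAt (circFlux P Q c) (∫ θ in -π..π,
      (cos θ * (cos θ * pd 0 P (circ c r θ) + sin θ * pd 1 P (circ c r θ)) +
        sin θ * (cos θ * pd 0 Q (circ c r θ) + sin θ * pd 1 Q (circ c r θ)))) r :=
    hasDerivAt_intervalIntegral_param hflux (by fun_prop)
      (fun r θ => ((hasDerivAt_comp_circ_radius hP c r θ).const_mul _).add
        ((hasDerivAt_comp_circ_radius hQ c r θ).const_mul _)) r
  have hs : ∀ {f : ℝ × ℝ → ℝ}, Continuous f → Continuous fun θ => f (r, θ) :=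
    fun h => h.comp (Continuous.prodMk_right r)
  have hang : ∀ θ ∈ Set.uIcc (-π) π, HasDerivAt
      (fun θ => -sin θ * P (circ c r θ) + cos θ * Q (circ c r θ))
      ((-cos θ * P (circ c r θ) +
        -sin θ * (r * (-sin θ * pd 0 P (circ c r θ) + cos θ * pd 1 P (circ c r θ)))) +
       (-sin θ * Q (circ c r θ) +
        cos θ * (r * (-sin θ * pd 0 Q (circ c r θ) + cos θ * pd 1 Q (circ c r θ))))) θ :=
    fun θ _ => ((hasDerivAt_sin θ).fun_neg.fun_mul (hasDerivAt_comp_circ_angle hP c r θ)).fun_add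
      ((hasDerivAt_cos θ).fun_mul (hasDerivAt_comp_circ_angle hQ c r θ))
  have k₀ := hs hc₀
  have k₁ := hs hc₁
  have k₂ := hs hc₂
  have k₃ := hs hc₃
  have kP := continuous_comp_circ_angle hP.continuous c r
  have kQ := continuous_comp_circ_angle hQ.continuous c r
  have hftc := intervalIntegral.integral_eq_sub_of_hasDerivAt hang
    (Continuous.intervalIntegrable (by fun_prop) _ _)
  have hper : circ c r (-π) = circ c r π := by simp [circ]
  simp only [hper, sin_neg, cos_neg, sin_pi] at hftc
  refine ((hasDerivAt_id r).fun_mul hrad).congr_deriv (Eq.symm ?_)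
  simp only [id, circInt, circFlux, one_mul]
  rw [← sub_eq_zero, ← intervalIntegral.integral_const_mul, ← intervalIntegral.integral_const_mul,
    ← intervalIntegral.integral_add (Continuous.intervalIntegrable (by fun_prop) _ _)
      (Continuous.intervalIntegrable (by fun_prop) _ _),
    ← intervalIntegral.integral_sub (Continuous.intervalIntegrable (by fun_prop) _ _)
      (Continuous.intervalIntegrable (by fun_prop) _ _)]
  trans ∫ θ in -π..π, ((-cos θ * P (circ c r θ) +
        -sin θ * (r * (-sin θ * pd 0 P (circ c r θ) + cos θ * pd 1 P (circ c r θ)))) +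
       (-sin θ * Q (circ c r θ) +
        cos θ * (r * (-sin θ * pd 0 Q (circ c r θ) + cos θ * pd 1 Q (circ c r θ)))))
  · congr 1
    funext θ
    linear_combination (-(r * pd 0 P (circ c r θ)) - r * pd 1 Q (circ c r θ)) * sin_sq_add_cos_sq θ
  · rw [hftc]
    ring

lemma hasDerivAt_mul_circFlux_grad (hF : ContDiff ℝ ∞ F) (c : R2) (r : ℝ) :
    HasDerivAt (fun r => r * circFlux (pd 0 F) (pd 1 F) c r) (r * circInt (lap F) c r) r := by
  rw [show lap F = fun z => _ from funext (lap_eq_pd F)]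
  exact hasDerivAt_mul_circFlux (hF.pd 0) (hF.pd 1) c r

end Circle

/-! ### Subharmonic functions -/

section Subharmonic

variable {F : R2 → ℝ}

lemma monotoneOn_mul_circFlux (hF : ContDiff ℝ ∞ F) {c : R2} {R : ℝ}
    (h : ∀ z, dist z c ≤ R → 0 ≤ lap F z) :
    MonotoneOn (fun r => r * circFlux (pd 0 F) (pd 1 F) c r) (Set.Icc 0 R) := by
  have hd := hasDerivAt_mul_circFlux_grad hF c
  refine monotoneOn_of_hasDerivWithinAt_nonneg (convex_Icc 0 R)
    (fun r _ => (hd r).continuousAt.continuousWithinAt) (fun r _ => (hd r).hasDerivWithinAt)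
    fun r hr => ?_
  rw [interior_Icc] at hr
  refine mul_nonneg hr.1.le (intervalIntegral.integral_nonneg (by linarith [pi_pos])
    fun θ _ => h _ ?_)
  rw [dist_circ, abs_of_pos hr.1]
  exact hr.2.le

/-- The circle averages of a subharmonic function increase with the radius. -/
lemma monotoneOn_circInt (hF : ContDiff ℝ ∞ F) {c : R2} {R : ℝ}
    (h : ∀ z, dist z c ≤ R → 0 ≤ lap F z) : MonotoneOn (circInt F c) (Set.Icc 0 R) := by
  have hd := hasDerivAt_circInt hF c
  refine monotoneOn_of_hasDerivWithinAt_nonneg (convex_Icc 0 R)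
    (fun r _ => (hd r).continuousAt.continuousWithinAt) (fun r _ => (hd r).hasDerivWithinAt)
    fun r hr => ?_
  rw [interior_Icc] at hr
  have := monotoneOn_mul_circFlux hF h ⟨le_rfl, (hr.1.trans hr.2).le⟩ ⟨hr.1.le, hr.2.le⟩ hr.1.le
  simp only [zero_mul] at this
  exact nonneg_of_mul_nonneg_right this hr.1

lemma circInt_eq_of_lap_eq_zero (hF : ContDiff ℝ ∞ F) (h : ∀ z, lap F z = 0) (c : R2) {r : ℝ}
    (hr : 0 ≤ r) : circInt F c r = 2 * π * F c := by
  rw [← circInt_zero]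
  have hneg : ∀ z, lap (fun z => -F z) z = 0 := by
    intro z
    have := h z
    rw [lap_eq_pd] at this ⊢
    simp only [pd_neg]
    linarith
  have h₁ := monotoneOn_circInt (R := r) hF (c := c) (fun z _ => (h z).ge) ⟨le_rfl, hr⟩
    ⟨hr, le_rfl⟩ hr
  have h₂ := monotoneOn_circInt (R := r) hF.neg (c := c) (fun z _ => (hneg z).ge) ⟨le_rfl, hr⟩
    ⟨hr, le_rfl⟩ hr
  simp only [circInt, intervalIntegral.integral_neg] at h₁ h₂ ⊢
  linarith

lemma measurePreserving_pair :
    MeasurePreserving (fun p : ℝ × ℝ => (!₂[p.1, p.2] : R2)) :=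
  (PiLp.volume_preserving_toLp (Fin 2)).comp (volume_preserving_finTwoArrow ℝ).symm

lemma measurableEmbedding_pair :
    MeasurableEmbedding (fun p : ℝ × ℝ => (!₂[p.1, p.2] : R2)) :=
  (MeasurableEquiv.toLp 2 (Fin 2 → ℝ)).measurableEmbedding.comp
    MeasurableEquiv.finTwoArrow.symm.measurableEmbedding

/-- Integration over a disc in polar coordinates. -/
lemma setIntegral_ball_eq (hF : Continuous F) (c : R2) {R : ℝ} (hR : 0 ≤ R) :
    ∫ z in Metric.ball c R, F z = ∫ r in 0..R, r * circInt F c r := by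
  have hcont : Continuous fun p : ℝ × ℝ => p.1 * F (circ c p.1 p.2) := by fun_prop
  have hint : IntegrableOn (fun p : ℝ × ℝ => p.1 * F (circ c p.1 p.2))
      (Set.Ioo 0 R ×ˢ Set.Ioo (-π) π) (volume.prod volume) :=
    (hcont.continuousOn.integrableOn_compact (isCompact_Icc.prod isCompact_Icc)).mono_set
      (Set.prod_mono Set.Ioo_subset_Icc_self Set.Ioo_subset_Icc_self)
  calc ∫ z in Metric.ball c R, F z
      = ∫ z, (Metric.ball c R).indicator F (c + z) := by
        rw [integral_add_left_eq_self, integral_indicator measurableSet_ball]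
    _ = ∫ p : ℝ × ℝ, (Metric.ball c R).indicator F (c + !₂[p.1, p.2]) :=
        (measurePreserving_pair.integral_comp measurableEmbedding_pair
          fun z => (Metric.ball c R).indicator F (c + z)).symm
    _ = ∫ p in Set.Ioi 0 ×ˢ Set.Ioo (-π) π,
          (Set.Iio R ×ˢ Set.univ).indicator (fun p => p.1 * F (circ c p.1 p.2)) p := by
        rw [← integral_comp_polarCoord_symm, polarCoord_target]
        refine setIntegral_congr_fun (measurableSet_Ioi.prod measurableSet_Ioo) fun p hp => ?_
        have hp₀ : 0 < p.1 := hp.1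
        have hcirc : c + !₂[(polarCoord.symm p).1, (polarCoord.symm p).2] = circ c p.1 p.2 := by
          ext i
          fin_cases i <;> simp [circ]
        have hmem : circ c p.1 p.2 ∈ Metric.ball c R ↔ p ∈ Set.Iio R ×ˢ Set.univ := by
          rw [Metric.mem_ball, dist_circ, abs_of_pos hp₀]
          simp
        simp only [hcirc, smul_eq_mul]
        by_cases h : p ∈ Set.Iio R ×ˢ (Set.univ : Set ℝ)
        · rw [Set.indicator_of_mem h, Set.indicator_of_mem (hmem.2 h)]
        · rw [Set.indicator_of_notMem h, Set.indicator_of_notMem (mt hmem.1 h), mul_zero]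
    _ = ∫ p in Set.Ioo 0 R ×ˢ Set.Ioo (-π) π, p.1 * F (circ c p.1 p.2) := by
        rw [setIntegral_indicator (measurableSet_Iio.prod MeasurableSet.univ), Set.prod_inter_prod,
          Set.inter_univ, Set.Ioi_inter_Iio]
    _ = ∫ r in 0..R, r * circInt F c r := by
        rw [Measure.volume_eq_prod, setIntegral_prod _ hint, intervalIntegral.integral_of_le hR,
          integral_Ioc_eq_integral_Ioo]
        refine integral_congr_ae (Filter.Eventually.of_forall fun r => ?_)
        simp only [circInt]
        rw [intervalIntegral.integral_of_le (by linarith [pi_pos]), integral_Ioc_eq_integral_Ioo,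
          integral_const_mul]

/-- The sub-mean-value property on discs. -/
lemma mul_le_setIntegral_ball (hF : ContDiff ℝ ∞ F) {c : R2} {R : ℝ} (hR : 0 ≤ R)
    (h : ∀ z, dist z c ≤ R → 0 ≤ lap F z) :
    π * R ^ 2 * F c ≤ ∫ z in Metric.ball c R, F z := by
  rw [setIntegral_ball_eq hF.continuous c hR]
  have hc : Continuous (circInt F c) := continuous_circInt hF.continuous c
  calc π * R ^ 2 * F c = ∫ r in 0..R, r * (2 * π * F c) := by
        rw [intervalIntegral.integral_mul_const, integral_id]
        ring
    _ ≤ ∫ r in 0..R, r * circInt F c r := by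
        refine intervalIntegral.integral_mono_on hR
          (Continuous.intervalIntegrable (by fun_prop) _ _)
          (Continuous.intervalIntegrable (by fun_prop) _ _) fun r hr => ?_
        refine mul_le_mul_of_nonneg_left ?_ hr.1
        rw [← circInt_zero]
        exact monotoneOn_circInt hF h ⟨le_rfl, hR⟩ hr hr.1

lemma integrableOn_ball (hF : Continuous F) (c : R2) (R : ℝ) :
    IntegrableOn F (Metric.ball c R) :=
  (hF.continuousOn.integrableOn_compact (isCompact_closedBall c R)).mono_set
    Metric.ball_subset_closedBall

lemma dist_sq_eq (z a : R2) :
    dist z a ^ 2 = (z 0 - a 0) * (z 0 - a 0) + (z 1 - a 1) * (z 1 - a 1) := by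
  rw [EuclideanSpace.dist_eq, Real.sq_sqrt (by positivity)]
  simp [Fin.sum_univ_two, Real.dist_eq, sq_abs]
  ring

lemma volume_real_ball (c : R2) {R : ℝ} (hR : 0 ≤ R) :
    volume.real (Metric.ball c R) = π * R ^ 2 := by
  simp [Measure.real, EuclideanSpace.volume_ball_fin_two, hR, pi_nonneg]
  ring

/-- A small-energy estimate for positive solutions of `Δv ≥ -B v²`. -/
lemma sq_mul_le_of_setIntegral_lt {v : R2 → ℝ} {B r : ℝ} {x : R2} (hv : ContDiff ℝ ∞ v)
    (hpos : ∀ z, 0 < v z) (hB : 0 < B) (hlap : ∀ z, -(B * v z ^ 2) ≤ lap v z) (hr : 0 < r)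
    (hsmall : ∫ z in Metric.ball x r, v z < π / (16 * B)) : r ^ 2 * v x ≤ 1 / (2 * B) := by
  obtain ⟨y, hy, hmax⟩ := (isCompact_closedBall x r).exists_isMaxOn
    ⟨x, Metric.mem_closedBall_self hr.le⟩
    (f := fun z => (r - dist z x) ^ 2 * v z) (by have := hv.continuous; fun_prop)
  have hmax' : ∀ z, dist z x ≤ r → (r - dist z x) ^ 2 * v z ≤ (r - dist y x) ^ 2 * v y :=
    fun z hz => hmax hz
  have hx := hmax' x (by simpa using hr.le)
  rw [dist_self, sub_zero] at hx
  have hyr : dist y x ≤ r := hy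
  set σ := (r - dist y x) / 2 with hσ
  have hσ₀ : 0 ≤ σ := by rw [hσ]; linarith
  set a := v y with ha
  have ha₀ : 0 < a := hpos y
  have hx' : r ^ 2 * v x ≤ 4 * (σ ^ 2 * a) := by
    refine hx.trans (le_of_eq ?_)
    rw [hσ]
    ring
  by_contra! hcon
  have hbig : 1 < 8 * B * a * σ ^ 2 := by
    have : 1 / (2 * B) < 4 * (σ ^ 2 * a) := hcon.trans_le hx'
    rw [div_lt_iff₀ (by positivity)] at this
    linarith
  have hσpos : 0 < σ := by
    rcases hσ₀.eq_or_lt with h | h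
    · rw [← h] at hbig
      norm_num at hbig
    · exact h
  have hbound : ∀ z, dist z y ≤ σ → v z ≤ 4 * a := by
    intro z hz
    have htri := dist_triangle z y x
    have h₁ : σ ≤ r - dist z x := by linarith
    have h₂ := hmax' z (by linarith)
    have h₃ : σ ^ 2 * v z ≤ σ ^ 2 * (4 * a) := by
      calc σ ^ 2 * v z ≤ (r - dist z x) ^ 2 * v z := by
            have := (hpos z).le
            gcongr
        _ ≤ _ := h₂
        _ = _ := by
            rw [hσ]
            ring
    exact le_of_mul_le_mul_left h₃ (by positivity)
  set ρ := √(1 / (8 * B * a)) with hρ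
  have hρ₀ : 0 ≤ ρ := sqrt_nonneg _
  have hρsq : ρ ^ 2 = 1 / (8 * B * a) := Real.sq_sqrt (by positivity)
  have hρσ : ρ ≤ σ := by
    refine (sq_le_sq₀ hρ₀ hσ₀).1 ?_
    rw [hρsq, div_le_iff₀ (by positivity)]
    linarith
  set q : R2 → ℝ := fun z => (z 0 - y 0) * (z 0 - y 0) + (z 1 - y 1) * (z 1 - y 1) with hq
  have hc : ∀ i, ContDiff ℝ ∞ fun z : R2 => z i - y i := fun i =>
    (contDiff_coord i).sub contDiff_const
  have hqs : ContDiff ℝ ∞ q := ((hc 0).mul (hc 0)).add ((hc 1).mul (hc 1))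
  have hpdq : ∀ i, pd i q = fun z => 2 * (z i - y i) := by
    intro i
    rw [hq, pd_add ((hc 0).mul (hc 0)) ((hc 1).mul (hc 1)), pd_mul (hc 0) (hc 0),
      pd_mul (hc 1) (hc 1), pd_sub (contDiff_coord 0) contDiff_const,
      pd_sub (contDiff_coord 1) contDiff_const, pd_coord, pd_coord, pd_const, pd_const]
    funext z
    fin_cases i <;> simp <;> ring
  have hlapq : ∀ z, lap q z = 4 := by
    intro z
    rw [lap_eq_pd, hpdq, hpdq, pd_const_mul (hc 0), pd_const_mul (hc 1),
      pd_sub (contDiff_coord 0) contDiff_const, pd_sub (contDiff_coord 1) contDiff_const,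
      pd_coord, pd_coord, pd_const, pd_const]
    norm_num
  set k := 4 * B * a ^ 2 with hk
  have hkq : ContDiff ℝ ∞ fun z => k * q z := contDiff_const.mul hqs
  have hlapF : ∀ z, lap (fun z => v z + k * q z) z = lap v z + 4 * k := by
    intro z
    have h := hlapq z
    rw [lap_eq_pd] at h ⊢
    rw [lap_eq_pd, pd_add hv hkq, pd_add hv hkq, pd_const_mul hqs, pd_const_mul hqs,
      pd_add (hv.pd 0) (contDiff_const.mul (hqs.pd 0)),
      pd_add (hv.pd 1) (contDiff_const.mul (hqs.pd 1)),
      pd_const_mul (hqs.pd 0), pd_const_mul (hqs.pd 1)]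
    linear_combination k * h
  have hmv := mul_le_setIntegral_ball (hv.add hkq) (c := y) hρ₀ (fun z hz => by
    rw [hlapF]
    have h₁ := hlap z
    have h₂ : v z ^ 2 ≤ (4 * a) ^ 2 :=
      pow_le_pow_left₀ (hpos z).le (hbound z (hz.trans hρσ)) 2
    have h₃ : B * v z ^ 2 ≤ B * (4 * a) ^ 2 := mul_le_mul_of_nonneg_left h₂ hB.le
    rw [hk]
    nlinarith)
  have hupper : ∫ z in Metric.ball y ρ, (v z + k * q z) ≤
      (∫ z in Metric.ball y ρ, v z) + k * ρ ^ 2 * (π * ρ ^ 2) := by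
    have hvi := integrableOn_ball hv.continuous y ρ
    have hci : IntegrableOn (fun _ : R2 => k * ρ ^ 2) (Metric.ball y ρ) :=
      integrableOn_ball continuous_const y ρ
    calc _ ≤ ∫ z in Metric.ball y ρ, (v z + k * ρ ^ 2) := by
          refine setIntegral_mono_on (integrableOn_ball (hv.add hkq).continuous y ρ)
            (hvi.add hci) measurableSet_ball fun z hz => ?_
          have : q z ≤ ρ ^ 2 := by
            rw [hq]
            simp only
            rw [← dist_sq_eq]
            exact pow_le_pow_left₀ dist_nonneg (Metric.mem_ball.1 hz).le 2
          have hk₀ : 0 ≤ k := by positivity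
          gcongr
      _ = _ := by
          rw [integral_add hvi hci, setIntegral_const, volume_real_ball y hρ₀, smul_eq_mul]
          ring
  have hsub : ∫ z in Metric.ball y ρ, v z ≤ ∫ z in Metric.ball x r, v z := by
    refine setIntegral_mono_set (integrableOn_ball hv.continuous x r)
      (Filter.Eventually.of_forall fun z => (hpos z).le) (LE.le.eventuallyLE ?_)
    refine Metric.ball_subset_ball' ?_
    linarith
  have hqy : q y = 0 := by simp [hq]
  have hfin : π * ρ ^ 2 * a < π / (16 * B) + k * ρ ^ 2 * (π * ρ ^ 2) := by
    have : π * ρ ^ 2 * (v y + k * q y) = π * ρ ^ 2 * a := by rw [hqy, ha]; ring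
    linarith
  rw [hρsq, hk] at hfin
  have h₁ : π * (1 / (8 * B * a)) * a = π / (8 * B) := by field_simp
  have h₂ : 4 * B * a ^ 2 * (1 / (8 * B * a)) * (π * (1 / (8 * B * a))) = π / (16 * B) := by
    field_simp
    norm_num
  rw [h₁, h₂] at hfin
  have h₃ : π / (16 * B) + π / (16 * B) = π / (8 * B) := by
    field_simp
    norm_num
  linarith

/-- An integrable positive solution of `Δv ≥ -B v²` on the plane is bounded. -/
lemma exists_bound_of_integrable {v : R2 → ℝ} {B : ℝ} (hv : ContDiff ℝ ∞ v)
    (hpos : ∀ z, 0 < v z) (hB : 0 < B) (hlap : ∀ z, -(B * v z ^ 2) ≤ lap v z)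
    (hint : Integrable v) : ∃ C, ∀ z, v z ≤ C := by
  have hfin : ∫⁻ z, ENNReal.ofReal (v z) ≠ ⊤ :=
    (hasFiniteIntegral_iff_ofReal (Filter.Eventually.of_forall fun z => (hpos z).le)).1
      hint.hasFiniteIntegral |>.ne
  have hε : ENNReal.ofReal (π / (16 * B)) ≠ 0 := by
    have := pi_pos
    simp only [ne_eq, ENNReal.ofReal_eq_zero, not_le]
    positivity
  obtain ⟨δ, hδ, hδ'⟩ := exists_pos_setLIntegral_lt_of_measure_lt hfin hε
  obtain ⟨r, hr, hrδ⟩ : ∃ r : ℝ, 0 < r ∧ ENNReal.ofReal r ^ 2 * ENNReal.ofReal π < δ := by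
    have hlim : Filter.Tendsto (fun r : ℝ => ENNReal.ofReal (r ^ 2 * π)) (𝓝[>] 0) (𝓝 0) := by
      have : Continuous fun r : ℝ => ENNReal.ofReal (r ^ 2 * π) :=
        ENNReal.continuous_ofReal.comp (by fun_prop)
      simpa using (this.tendsto 0).mono_left nhdsWithin_le_nhds
    obtain ⟨r, h₁, h₂⟩ := ((hlim.eventually_lt_const hδ).and self_mem_nhdsWithin).exists
    refine ⟨r, h₂, ?_⟩
    rwa [ENNReal.ofReal_mul (by positivity), ENNReal.ofReal_pow (le_of_lt h₂)] at h₁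
  refine ⟨1 / (2 * B) / r ^ 2, fun x => ?_⟩
  rw [le_div_iff₀ (by positivity), mul_comm]
  refine sq_mul_le_of_setIntegral_lt hv hpos hB hlap hr ?_
  have h := hδ' (Metric.ball x r) (by rwa [EuclideanSpace.volume_ball_fin_two])
  rw [← ofReal_integral_eq_lintegral_ofReal (integrableOn_ball hv.continuous x r)
    (Filter.Eventually.of_forall fun z => (hpos z).le)] at h
  exact (ENNReal.ofReal_lt_ofReal_iff (by have := pi_pos; positivity)).1 h

end Subharmonic

/-! ### Growth and energy of subharmonic functions with finite Riesz mass -/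

section Growth

variable {F s : R2 → ℝ} {c : R2}

lemma mul_circFlux_eq_integral {P Q : R2 → ℝ} (hP : ContDiff ℝ ∞ P) (hQ : ContDiff ℝ ∞ Q)
    (c : R2) (r : ℝ) :
    r * circFlux P Q c r = ∫ t in 0..r, t * circInt (fun z => pd 0 P z + pd 1 Q z) c t := by
  have hc : Continuous (circInt (fun z => pd 0 P z + pd 1 Q z) c) :=
    continuous_circInt ((hP.pd 0).continuous.add (hQ.pd 1).continuous) c
  rw [intervalIntegral.integral_eq_sub_of_hasDerivAt
    (fun t _ => hasDerivAt_mul_circFlux hP hQ c t)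
    (Continuous.intervalIntegrable (by fun_prop) _ _)]
  ring

lemma mul_circFlux_grad_eq_integral (hF : ContDiff ℝ ∞ F) (c : R2) (r : ℝ) :
    r * circFlux (pd 0 F) (pd 1 F) c r = ∫ t in 0..r, t * circInt (lap F) c t := by
  rw [show lap F = fun z => _ from funext (lap_eq_pd F)]
  exact mul_circFlux_eq_integral (hF.pd 0) (hF.pd 1) c r

lemma circInt_le_add_log (hF : ContDiff ℝ ∞ F) (hlap : ∀ z, 0 ≤ lap F z)
    (hint : Integrable (lap F)) (c : R2) {r : ℝ} (hr : 1 ≤ r) :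
    circInt F c r ≤ circInt F c 1 + (∫ z, lap F z) * log r := by
  set M := ∫ z, lap F z with hM
  have hd : ∀ t, 1 ≤ t → HasDerivAt (fun t => M * log t - circInt F c t)
      (M * t⁻¹ - circFlux (pd 0 F) (pd 1 F) c t) t := fun t ht =>
    ((Real.hasDerivAt_log (by positivity)).const_mul M).sub (hasDerivAt_circInt hF c t)
  have hmono : MonotoneOn (fun t => M * log t - circInt F c t) (Set.Ici 1) := by
    refine monotoneOn_of_hasDerivWithinAt_nonneg (convex_Ici 1)
      (fun t ht => (hd t ht).continuousAt.continuousWithinAt)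
      (fun t ht => (hd t (interior_subset ht)).hasDerivWithinAt) fun t ht => ?_
    have ht₁ : 1 ≤ t := Set.mem_Ici.1 (interior_subset ht)
    have ht₀ : 0 < t := by linarith
    have h : t * circFlux (pd 0 F) (pd 1 F) c t ≤ M := by
      rw [mul_circFlux_grad_eq_integral hF, ← setIntegral_ball_eq hF.lap.continuous c ht₀.le]
      exact setIntegral_le_integral hint (Filter.Eventually.of_forall hlap)
    rw [sub_nonneg, ← div_eq_mul_inv, le_div_iff₀ ht₀, mul_comm]
    exact h
  have h := hmono (Set.mem_Ici.2 le_rfl) (Set.mem_Ici.2 hr) hr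
  simp only [log_one, mul_zero] at h
  linarith

lemma exists_le_mul_sqrt (hs : ContDiff ℝ ∞ s) (hs₀ : ∀ z, 0 ≤ s z) (hlap : ∀ z, 0 ≤ lap s z)
    (hint : Integrable (lap s)) (c : R2) :
    ∃ C, ∀ R, 1 ≤ R → ∀ z, dist z c ≤ R → s z ≤ C * √R := by
  set A := circInt s c 1 with hA
  set M := ∫ z, lap s z with hM
  have hA₀ : 0 ≤ A := circInt_nonneg hs₀ c 1
  have hM₀ : 0 ≤ M := integral_nonneg hlap
  refine ⟨2 / π * (A + 4 * M), fun R hR z hz => ?_⟩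
  have hR₀ : 0 < R := by linarith
  have hcont : Continuous (circInt s c) := continuous_circInt hs.continuous c
  have hsq : 1 ≤ √R := Real.one_le_sqrt.2 hR
  have hRsq : √R ^ 2 = R := Real.sq_sqrt hR₀.le
  have hlog : log (2 * R) ≤ 4 * √R := by
    have h₁ : log (2 * R) = log 2 + 2 * log √R := by
      rw [log_mul two_ne_zero hR₀.ne', Real.log_sqrt hR₀.le]
      ring
    have h₂ := Real.log_le_sub_one_of_pos (show (0 : ℝ) < 2 by norm_num)
    have h₃ := Real.log_le_sub_one_of_pos (show 0 < √R by linarith)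
    linarith
  have hcirc : circInt s c (2 * R) ≤ (A + 4 * M) * √R := by
    have h₁ := circInt_le_add_log hs hlap hint c (show 1 ≤ 2 * R by linarith)
    have h₂ : M * log (2 * R) ≤ M * (4 * √R) := mul_le_mul_of_nonneg_left hlog hM₀
    have h₃ : A * 1 ≤ A * √R := mul_le_mul_of_nonneg_left hsq hA₀
    linarith
  have hmain : π * R ^ 2 * s z ≤ 2 * R ^ 2 * circInt s c (2 * R) := by
    calc π * R ^ 2 * s z ≤ ∫ w in Metric.ball z R, s w :=
          mul_le_setIntegral_ball hs hR₀.le fun w _ => hlap w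
      _ ≤ ∫ w in Metric.ball c (2 * R), s w := by
          refine setIntegral_mono_set (integrableOn_ball hs.continuous c (2 * R))
            (Filter.Eventually.of_forall hs₀) (LE.le.eventuallyLE ?_)
          refine Metric.ball_subset_ball' ?_
          linarith
      _ = ∫ r in 0..(2 * R), r * circInt s c r :=
          setIntegral_ball_eq hs.continuous c (by linarith)
      _ ≤ ∫ r in 0..(2 * R), r * circInt s c (2 * R) := by
          refine intervalIntegral.integral_mono_on (by linarith)
            (Continuous.intervalIntegrable (by fun_prop) _ _)
            (Continuous.intervalIntegrable (by fun_prop) _ _) fun r hr => ?_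
          exact mul_le_mul_of_nonneg_left (monotoneOn_circInt hs (fun w _ => hlap w) hr
            ⟨by linarith, le_rfl⟩ hr.2) hr.1
      _ = 2 * R ^ 2 * circInt s c (2 * R) := by
          rw [intervalIntegral.integral_mul_const, integral_id]
          ring
  have h : R ^ 2 * (π * s z) ≤ R ^ 2 * (2 * circInt s c (2 * R)) := by linarith
  have h' := le_of_mul_le_mul_left h (by positivity)
  have : s z ≤ 2 * ((A + 4 * M) * √R) / π := by
    rw [le_div_iff₀ pi_pos]
    linarith
  refine this.trans (le_of_eq ?_)
  ring

/-- The squared length of the gradient. -/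
noncomputable def gradSq (F : R2 → ℝ) (z : R2) : ℝ := pd 0 F z ^ 2 + pd 1 F z ^ 2

lemma gradSq_nonneg (F : R2 → ℝ) (z : R2) : 0 ≤ gradSq F z :=
  add_nonneg (sq_nonneg _) (sq_nonneg _)

lemma continuous_gradSq (hF : ContDiff ℝ ∞ F) : Continuous (gradSq F) :=
  ((hF.pd 0).continuous.pow 2).add ((hF.pd 1).continuous.pow 2)

lemma lap_sq (hF : ContDiff ℝ ∞ F) (z : R2) :
    lap (fun z => F z * F z) z = 2 * (F z * lap F z) + 2 * gradSq F z := by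
  have h : ∀ i, pd i (pd i fun z => F z * F z) z = 2 * (F z * pd i (pd i F) z + pd i F z ^ 2) := by
    intro i
    rw [pd_mul hF hF, pd_add (hF.mul (hF.pd i)) (hF.mul (hF.pd i)), pd_mul hF (hF.pd i)]
    ring
  rw [lap_eq_pd, lap_eq_pd, h, h, gradSq]
  ring

lemma circInt_const_mul (a : ℝ) (F : R2 → ℝ) (c : R2) (r : ℝ) :
    circInt (fun z => a * F z) c r = a * circInt F c r := by
  simp only [circInt, intervalIntegral.integral_const_mul]

lemma intervalIntegral_energy_mono (hF : ContDiff ℝ ∞ F) (c : R2) {r R : ℝ} (hr : 0 ≤ r)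
    (hrR : r ≤ R) :
    ∫ t in 0..r, t * circInt (gradSq F) c t ≤ ∫ t in 0..R, t * circInt (gradSq F) c t := by
  have hc : Continuous (circInt (gradSq F) c) := continuous_circInt (continuous_gradSq hF) c
  have hi : ∀ a b, IntervalIntegrable (fun t => t * circInt (gradSq F) c t) volume a b :=
    fun a b => Continuous.intervalIntegrable (by fun_prop) _ _
  rw [← intervalIntegral.integral_add_adjacent_intervals (hi 0 r) (hi r R)]
  have := intervalIntegral.integral_nonneg hrR (μ := volume)
    (f := fun t => t * circInt (gradSq F) c t) fun t ht =>
      mul_nonneg (hr.trans ht.1) (circInt_nonneg (gradSq_nonneg F) c t)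
  linarith

/-- Caccioppoli-type estimate for nonnegative subharmonic functions. -/
lemma exists_energy_le (hs : ContDiff ℝ ∞ s) (hs₀ : ∀ z, 0 ≤ s z) (hlap : ∀ z, 0 ≤ lap s z)
    (hint : Integrable (lap s)) (c : R2) :
    ∃ C, ∀ R, 1 ≤ R → ∫ t in 0..R, t * circInt (gradSq s) c t ≤ C * R := by
  obtain ⟨C, hC⟩ := exists_le_mul_sqrt hs hs₀ hlap hint c
  refine ⟨4 * π * C ^ 2, fun R hR => ?_⟩
  have hR₀ : 0 < R := by linarith
  set D : ℝ → ℝ := fun r => ∫ t in 0..r, t * circInt (gradSq s) c t with hD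
  have hg : ContDiff ℝ ∞ fun z => s z * s z := hs.mul hs
  have hcE : Continuous (circInt (gradSq s) c) := continuous_circInt (continuous_gradSq hs) c
  have hcG : Continuous (circInt (lap fun z => s z * s z) c) :=
    continuous_circInt hg.lap.continuous c
  obtain ⟨ξ, hξ, hslope⟩ := exists_hasDerivAt_eq_slope (circInt (fun z => s z * s z) c) _
    (show R < 2 * R by linarith) (continuous_circInt hg.continuous c).continuousOn
    fun r _ => hasDerivAt_circInt hg c r
  set φ := circFlux (pd 0 fun z => s z * s z) (pd 1 fun z => s z * s z) c ξ with hφ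
  have hξ₀ : 0 < ξ := hR₀.trans hξ.1
  have hflux : 2 * D ξ ≤ ξ * φ := by
    rw [hφ, mul_circFlux_grad_eq_integral hg, hD]
    simp only
    rw [← intervalIntegral.integral_const_mul]
    refine intervalIntegral.integral_mono_on hξ₀.le
      (Continuous.intervalIntegrable (by fun_prop) _ _)
      (Continuous.intervalIntegrable (by fun_prop) _ _) fun t ht => ?_
    rw [mul_left_comm, ← circInt_const_mul]
    refine mul_le_mul_of_nonneg_left (circInt_mono
      (continuous_const.mul (continuous_gradSq hs)) hg.lap.continuous fun z _ => ?_) ht.1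
    rw [lap_sq hs]
    change 2 * gradSq s z ≤ _
    have := mul_nonneg (hs₀ z) (hlap z)
    linarith
  have hDmono : D R ≤ D ξ := intervalIntegral_energy_mono hs c hR₀.le hξ.1.le
  have hD₀ : 0 ≤ D R := intervalIntegral.integral_nonneg hR₀.le fun t ht =>
    mul_nonneg ht.1 (circInt_nonneg (gradSq_nonneg s) c t)
  have hφ₀ : 0 ≤ φ := by
    have : 0 ≤ ξ * φ := by linarith
    exact nonneg_of_mul_nonneg_right this hξ₀
  have hDφ : D R ≤ R * φ := by
    have : ξ * φ ≤ 2 * R * φ := mul_le_mul_of_nonneg_right hξ.2.le hφ₀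
    linarith
  have hslope' : R * φ = circInt (fun z => s z * s z) c (2 * R) -
      circInt (fun z => s z * s z) c R := by
    rw [hslope]
    field_simp
    ring
  have hupper : circInt (fun z => s z * s z) c (2 * R) ≤ 2 * π * (C ^ 2 * (2 * R)) := by
    rw [← circInt_const (C ^ 2 * (2 * R)) c (2 * R)]
    refine circInt_mono hg.continuous continuous_const fun z hz => ?_
    rw [abs_of_pos (by linarith)] at hz
    have h := hC (2 * R) (by linarith) z hz.le
    calc s z * s z ≤ (C * √(2 * R)) * (C * √(2 * R)) := mul_self_le_mul_self (hs₀ z) h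
      _ = C ^ 2 * (√(2 * R) * √(2 * R)) := by ring
      _ = _ := by rw [Real.mul_self_sqrt (by linarith)]
  have hlower : 0 ≤ circInt (fun z => s z * s z) c R :=
    circInt_nonneg (fun z => mul_self_nonneg _) c R
  change D R ≤ _
  linarith

/-- A harmonic function of the form `div (P, Q) - N`, with `P² + Q²` and `|N|` bounded by an energy
density of at most linear growth, vanishes at the centre. -/
lemma harmonic_eq_zero_of_energy_le {u a P Q N : R2 → ℝ} (hu : ContDiff ℝ ∞ u)
    (ha : ContDiff ℝ ∞ a) (hP : ContDiff ℝ ∞ P) (hQ : ContDiff ℝ ∞ Q) (hN : Continuous N)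
    (hharm : ∀ z, lap a z = 0) (hdiv : ∀ z, pd 0 P z + pd 1 Q z = a z + N z)
    (hPQ : ∀ z, P z ^ 2 + Q z ^ 2 ≤ gradSq u z) (hNu : ∀ z, |N z| ≤ gradSq u z) {C : ℝ}
    (hen : ∀ R, 1 ≤ R → ∫ t in 0..R, t * circInt (gradSq u) c t ≤ C * R) : a c = 0 := by
  have hcE : Continuous (circInt (gradSq u) c) := continuous_circInt (continuous_gradSq hu) c
  have hcN : Continuous (circInt N c) := continuous_circInt hN c
  have hcJ : Continuous (circFlux P Q c) := continuous_circFlux hP.continuous hQ.continuous c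
  have hEang : ∀ r, Continuous fun θ => gradSq u (circ c r θ) :=
    fun r => continuous_comp_circ_angle (continuous_gradSq hu) c r
  have hpi : -π ≤ π := by linarith [pi_pos]
  have hNabs : ∀ r, |circInt N c r| ≤ circInt (gradSq u) c r := fun r =>
    intervalIntegral.norm_integral_le_of_norm_le (μ := volume)
      (f := fun θ => N (circ c r θ)) (g := fun θ => gradSq u (circ c r θ)) hpi
      (Filter.Eventually.of_forall fun θ _ => hNu _) ((hEang r).intervalIntegrable _ _)
  have hJabs : ∀ r, |circFlux P Q c r| ≤ π + 1 / 2 * circInt (gradSq u) c r := by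
    intro r
    have hhalf : Continuous fun θ => 1 / 2 * gradSq u (circ c r θ) :=
      continuous_const.mul (hEang r)
    have h := intervalIntegral.norm_integral_le_of_norm_le (μ := volume) hpi
      (f := fun θ => cos θ * P (circ c r θ) + sin θ * Q (circ c r θ))
      (g := fun θ => 1 / 2 + 1 / 2 * gradSq u (circ c r θ))
      (Filter.Eventually.of_forall fun θ _ => ?_) ((continuous_const.add hhalf).intervalIntegrable _ _)
    · rw [intervalIntegral.integral_add intervalIntegrable_const
        (hhalf.intervalIntegrable _ _),
        intervalIntegral.integral_const_mul, intervalIntegral.integral_const, smul_eq_mul] at h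
      refine h.trans (le_of_eq ?_)
      rw [circInt]
      ring
    · have h₁ := hPQ (circ c r θ)
      have h₂ := sin_sq_add_cos_sq θ
      set p := P (circ c r θ)
      set q := Q (circ c r θ)
      have h₃ : (cos θ * p + sin θ * q) ^ 2 ≤ p ^ 2 + q ^ 2 := by
        have : (cos θ * p + sin θ * q) ^ 2 + (sin θ * p - cos θ * q) ^ 2 = p ^ 2 + q ^ 2 := by
          linear_combination (p ^ 2 + q ^ 2) * h₂
        linarith [sq_nonneg (sin θ * p - cos θ * q)]
      rw [Real.norm_eq_abs, abs_le]
      constructor <;>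
        nlinarith [sq_nonneg (cos θ * p + sin θ * q - 1), sq_nonneg (cos θ * p + sin θ * q + 1)]
  set D : ℝ → ℝ := fun r => ∫ t in 0..r, t * circInt (gradSq u) c t with hD
  have hflux : ∀ r, 0 ≤ r →
      r * circFlux P Q c r = π * r ^ 2 * a c + ∫ t in 0..r, t * circInt N c t := by
    intro r hr
    rw [mul_circFlux_eq_integral hP hQ]
    have hsplit : ∀ t ∈ Set.uIcc 0 r, t * circInt (fun z => pd 0 P z + pd 1 Q z) c t =
        t * (2 * π * a c) + t * circInt N c t := by
      intro t ht
      rw [Set.uIcc_of_le hr] at ht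
      rw [← circInt_eq_of_lap_eq_zero ha hharm c ht.1]
      simp only [hdiv]
      simp only [circInt]
      rw [intervalIntegral.integral_add
        ((continuous_comp_circ_angle ha.continuous c t).intervalIntegrable _ _)
        ((continuous_comp_circ_angle hN c t).intervalIntegrable _ _)]
      ring
    rw [intervalIntegral.integral_congr hsplit, intervalIntegral.integral_add
      (Continuous.intervalIntegrable (by fun_prop) _ _)
      (Continuous.intervalIntegrable (by fun_prop) _ _), intervalIntegral.integral_mul_const,
      integral_id]
    ring
  have hnD : ∀ R r, 0 ≤ r → r ≤ R → |∫ t in 0..r, t * circInt N c t| ≤ D R := by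
    intro R r hr hrR
    refine le_trans ?_ (intervalIntegral_energy_mono hu c hr hrR)
    refine intervalIntegral.norm_integral_le_of_norm_le (f := fun t => t * circInt N c t)
      (g := fun t => t * circInt (gradSq u) c t) hr
      (Filter.Eventually.of_forall fun t ht => ?_)
      (Continuous.intervalIntegrable (by fun_prop) _ _)
    rw [norm_mul, Real.norm_of_nonneg ht.1.le]
    exact mul_le_mul_of_nonneg_left (hNabs t) ht.1.le
  have hest : ∀ R, 1 ≤ R → |a c| * R ≤ 3 / π * (π / 2 + 3 / 2 * |C|) := by
    intro R hR
    have hR₀ : 0 < R := by linarith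
    have hDR : D R ≤ |C| * R := (hen R hR).trans (by gcongr; exact le_abs_self C)
    have h₁ : |∫ r in 0..R, r * circFlux P Q c r| ≤ π * R ^ 2 / 2 + 1 / 2 * D R := by
      have h := intervalIntegral.norm_integral_le_of_norm_le (μ := volume) hR₀.le
        (f := fun r => r * circFlux P Q c r)
        (g := fun r => r * π + 1 / 2 * (r * circInt (gradSq u) c r))
        (Filter.Eventually.of_forall fun r hr => ?_)
        (Continuous.intervalIntegrable (by fun_prop) _ _)
      · rw [intervalIntegral.integral_add (Continuous.intervalIntegrable (by fun_prop) _ _)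
          (Continuous.intervalIntegrable (by fun_prop) _ _), intervalIntegral.integral_mul_const,
          integral_id, intervalIntegral.integral_const_mul] at h
        refine h.trans (le_of_eq ?_)
        rw [hD]
        ring
      · rw [norm_mul, Real.norm_of_nonneg hr.1.le, Real.norm_eq_abs]
        have := mul_le_mul_of_nonneg_left (hJabs r) hr.1.le
        linarith
    have h₂ : |∫ r in 0..R, (r * circFlux P Q c r - π * a c * r ^ 2)| ≤ D R * R := by
      have h := intervalIntegral.norm_integral_le_of_norm_le_const (a := 0) (b := R)
        (f := fun r => r * circFlux P Q c r - π * a c * r ^ 2) (C := D R) fun r hr => ?_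
      · rwa [sub_zero, abs_of_pos hR₀] at h
      · rw [Set.uIoc_of_le hR₀.le] at hr
        rw [hflux r hr.1.le, Real.norm_eq_abs]
        convert hnD R r hr.1.le hr.2 using 2
        ring
    rw [intervalIntegral.integral_sub (Continuous.intervalIntegrable (by fun_prop) _ _)
      (Continuous.intervalIntegrable (by fun_prop) _ _), intervalIntegral.integral_const_mul,
      integral_pow] at h₂
    set H := ∫ r in 0..R, r * circFlux P Q c r
    have h₃ : |π * a c * (R ^ 3 / 3)| ≤ D R * R + (π * R ^ 2 / 2 + 1 / 2 * D R) := by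
      have h₄ : π * a c * (R ^ 3 / 3) =
          H - (H - π * a c * ((R ^ (2 + 1) - 0 ^ (2 + 1)) / ((2 : ℕ) + 1))) := by
        push_cast
        ring
      rw [h₄]
      exact (abs_sub _ _).trans (by linarith)
    rw [abs_mul, abs_mul, abs_of_pos pi_pos, abs_of_pos (by positivity : 0 < R ^ 3 / 3)] at h₃
    have h₅ : D R * R ≤ |C| * R * R := mul_le_mul_of_nonneg_right hDR hR₀.le
    have h₆ : |C| * R ≤ |C| * R * R := le_mul_of_one_le_right (by positivity) hR
    have h₇ : R ^ 2 * (π * (|a c| * R)) ≤ R ^ 2 * (3 * (π / 2 + 3 / 2 * |C|)) := by nlinarith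
    have h₈ := le_of_mul_le_mul_left h₇ (by positivity)
    rw [div_mul_eq_mul_div, le_div_iff₀ pi_pos]
    linarith
  by_contra hne
  have hpos : 0 < |a c| := abs_pos.2 hne
  set L := 3 / π * (π / 2 + 3 / 2 * |C|) with hL
  have hL₀ : 0 ≤ L := by
    have := pi_pos
    positivity
  have h := hest (L / |a c| + 1) (by linarith [div_nonneg hL₀ hpos.le])
  rw [mul_add, mul_div_cancel₀ _ hpos.ne'] at h
  linarith

end Growth

/-! ### Solutions of the Liouville equation -/

section Liouville

variable {u : R2 → ℝ} {K : ℝ}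

lemma contDiff_exp_two_mul (hu : ContDiff ℝ ∞ u) : ContDiff ℝ ∞ fun z => exp (2 * u z) :=
  (contDiff_const.mul hu).exp

lemma pd_exp_two_mul (hu : ContDiff ℝ ∞ u) (i : Fin 2) :
    pd i (fun z => exp (2 * u z)) = fun z => exp (2 * u z) * (2 * pd i u z) := by
  rw [pd_exp (contDiff_const.mul hu), pd_const_mul hu]

lemma lap_exp_two_mul (hu : ContDiff ℝ ∞ u) (z : R2) :
    lap (fun z => exp (2 * u z)) z = exp (2 * u z) * (2 * lap u z + 4 * gradSq u z) := by
  have h : ∀ i, pd i (pd i fun z => exp (2 * u z)) z =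
      exp (2 * u z) * (2 * pd i (pd i u) z + 4 * pd i u z ^ 2) := by
    intro i
    rw [pd_exp_two_mul hu, pd_mul (contDiff_exp_two_mul hu) (contDiff_const.mul (hu.pd i)),
      pd_const_mul (hu.pd i), pd_exp_two_mul hu]
    ring
  rw [lap_eq_pd, lap_eq_pd, h, h, gradSq]
  ring

lemma exists_energy_le_of_liouville (hK : 0 < K) (hu : ContDiff ℝ ∞ u)
    (heq : ∀ z, lap u z = -(K * exp (2 * u z))) (hint : Integrable fun z => exp (2 * u z))
    (c : R2) : ∃ C, ∀ R, 1 ≤ R → ∫ t in 0..R, t * circInt (gradSq u) c t ≤ C * R := by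
  obtain ⟨C, hC⟩ := exists_bound_of_integrable (B := 2 * K) (contDiff_exp_two_mul hu)
    (fun z => exp_pos _) (by positivity) (fun z => by
      rw [lap_exp_two_mul hu, heq]
      have := mul_nonneg (exp_pos (2 * u z)).le (gradSq_nonneg u z)
      nlinarith) hint
  set s : R2 → ℝ := fun z => log C / 2 - u z with hs
  have hss : ContDiff ℝ ∞ s := contDiff_const.sub hu
  have hs₀ : ∀ z, 0 ≤ s z := by
    intro z
    have h := Real.log_le_log (exp_pos _) (hC z)
    rw [log_exp] at h
    simp only [hs]
    linarith
  have hpd : ∀ i, pd i s = fun z => -pd i u z := by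
    intro i
    rw [hs, pd_sub contDiff_const hu, pd_const]
    simp
  have hlap : lap s = fun z => K * exp (2 * u z) := by
    funext z
    have h := heq z
    rw [lap_eq_pd] at h ⊢
    rw [hpd, hpd, pd_neg, pd_neg]
    linarith
  have hgrad : gradSq s = gradSq u := by
    funext z
    simp [gradSq, hpd]
  have h := exists_energy_le hss hs₀ (fun z => by rw [hlap]; positivity)
    (by rw [hlap]; exact hint.const_mul K) c
  rwa [hgrad] at h

/-- The real part of the holomorphic quadratic differential of `u`. -/
noncomputable def hopfRe (u : R2 → ℝ) (z : R2) : ℝ :=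
  pd 0 (pd 0 u) z - pd 1 (pd 1 u) z - (pd 0 u z * pd 0 u z - pd 1 u z * pd 1 u z)

/-- The imaginary part of the holomorphic quadratic differential of `u`. -/
noncomputable def hopfIm (u : R2 → ℝ) (z : R2) : ℝ :=
  2 * (pd 0 u z * pd 1 u z) - 2 * pd 0 (pd 1 u) z

lemma contDiff_hopfRe (hu : ContDiff ℝ ∞ u) : ContDiff ℝ ∞ (hopfRe u) :=
  (((hu.pd 0).pd 0).sub ((hu.pd 1).pd 1)).sub
    (((hu.pd 0).mul (hu.pd 0)).sub ((hu.pd 1).mul (hu.pd 1)))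

lemma contDiff_hopfIm (hu : ContDiff ℝ ∞ u) : ContDiff ℝ ∞ (hopfIm u) :=
  (contDiff_const.mul ((hu.pd 0).mul (hu.pd 1))).sub (contDiff_const.mul ((hu.pd 1).pd 0))

lemma pd_hopfRe (hu : ContDiff ℝ ∞ u) (i : Fin 2) (z : R2) :
    pd i (hopfRe u) z = pd i (pd 0 (pd 0 u)) z - pd i (pd 1 (pd 1 u)) z -
      (2 * (pd 0 u z * pd i (pd 0 u) z) - 2 * (pd 1 u z * pd i (pd 1 u) z)) := by
  have h₀ := hu.pd 0
  have h₁ := hu.pd 1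
  unfold hopfRe
  rw [pd_sub ((h₀.pd 0).sub (h₁.pd 1)) ((h₀.mul h₀).sub (h₁.mul h₁)),
    pd_sub (h₀.pd 0) (h₁.pd 1), pd_sub (h₀.mul h₀) (h₁.mul h₁), pd_mul h₀ h₀, pd_mul h₁ h₁]
  ring

lemma pd_hopfIm (hu : ContDiff ℝ ∞ u) (i : Fin 2) (z : R2) :
    pd i (hopfIm u) z = 2 * (pd 0 u z * pd i (pd 1 u) z + pd 1 u z * pd i (pd 0 u) z) -
      2 * pd i (pd 0 (pd 1 u)) z := by
  have h₀ := hu.pd 0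
  have h₁ := hu.pd 1
  unfold hopfIm
  rw [pd_sub (contDiff_const.mul (h₀.mul h₁)) (contDiff_const.mul (h₁.pd 0)),
    pd_const_mul (h₀.mul h₁), pd_const_mul (h₁.pd 0), pd_mul h₀ h₁]

lemma pd_lap_of_liouville (hu : ContDiff ℝ ∞ u) (heq : ∀ z, lap u z = -(K * exp (2 * u z)))
    (i : Fin 2) (z : R2) :
    pd i (pd 0 (pd 0 u)) z + pd i (pd 1 (pd 1 u)) z =
      2 * pd i u z * (pd 0 (pd 0 u) z + pd 1 (pd 1 u) z) := by
  have hlap : lap u = fun z => -(K * exp (2 * u z)) := funext heq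
  have h : pd i (lap u) z = 2 * pd i u z * lap u z := by
    rw [hlap, pd_neg, pd_const_mul (contDiff_exp_two_mul hu), pd_exp_two_mul hu]
    ring
  rwa [show lap u = fun z => _ from funext (lap_eq_pd u),
    pd_add ((hu.pd 0).pd 0) ((hu.pd 1).pd 1)] at h

/-- The Cauchy–Riemann equations for the quadratic differential of a solution. -/
lemma pd_hopfRe_eq (hu : ContDiff ℝ ∞ u) (heq : ∀ z, lap u z = -(K * exp (2 * u z))) :
    pd 0 (hopfRe u) = pd 1 (hopfIm u) ∧ pd 1 (hopfRe u) = fun z => -pd 0 (hopfIm u) z := by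
  have hc : pd 1 (pd 0 u) = pd 0 (pd 1 u) := pd_comm hu 1 0
  constructor
  · funext z
    rw [pd_hopfRe hu, pd_hopfIm hu, hc, pd_comm (hu.pd 1) 1 0]
    linear_combination pd_lap_of_liouville hu heq 0 z
  · funext z
    have hc' : pd 1 (pd 0 (pd 0 u)) = pd 0 (pd 0 (pd 1 u)) := by
      rw [pd_comm (hu.pd 0) 1 0, hc]
    have h := pd_lap_of_liouville hu heq 1 z
    rw [hc'] at h
    rw [pd_hopfRe hu, pd_hopfIm hu, hc, hc']
    linear_combination -h

lemma lap_hopfRe (hu : ContDiff ℝ ∞ u) (heq : ∀ z, lap u z = -(K * exp (2 * u z))) (z : R2) :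
    lap (hopfRe u) z = 0 := by
  obtain ⟨h₀, h₁⟩ := pd_hopfRe_eq hu heq
  rw [lap_eq_pd, h₀, h₁, pd_neg, pd_comm (contDiff_hopfIm hu) 0 1]
  ring

lemma lap_hopfIm (hu : ContDiff ℝ ∞ u) (heq : ∀ z, lap u z = -(K * exp (2 * u z))) (z : R2) :
    lap (hopfIm u) z = 0 := by
  obtain ⟨h₀, h₁⟩ := pd_hopfRe_eq hu heq
  have h₁' : pd 0 (hopfIm u) = fun z => -pd 1 (hopfRe u) z := by
    funext z
    rw [h₁]
    ring
  rw [lap_eq_pd, ← h₀, h₁', pd_neg, pd_comm (contDiff_hopfRe hu) 0 1]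
  ring

lemma hopfRe_eq_zero (hK : 0 < K) (hu : ContDiff ℝ ∞ u)
    (heq : ∀ z, lap u z = -(K * exp (2 * u z))) (hint : Integrable fun z => exp (2 * u z))
    (c : R2) : hopfRe u c = 0 := by
  obtain ⟨C, hC⟩ := exists_energy_le_of_liouville hK hu heq hint c
  have h₀ := hu.pd 0
  have h₁ := hu.pd 1
  refine harmonic_eq_zero_of_energy_le (P := pd 0 u) (Q := fun z => -pd 1 u z)
    (N := fun z => pd 0 u z * pd 0 u z - pd 1 u z * pd 1 u z) hu (contDiff_hopfRe hu) h₀ h₁.neg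
    ((h₀.mul h₀).sub (h₁.mul h₁)).continuous (lap_hopfRe hu heq) (fun z => ?_) (fun z => ?_)
    (fun z => ?_) hC
  · rw [pd_neg, hopfRe]
    ring
  · rw [gradSq, neg_sq]
  · rw [gradSq, abs_le]
    constructor <;> nlinarith [sq_nonneg (pd 0 u z), sq_nonneg (pd 1 u z)]

lemma hopfIm_eq_zero (hK : 0 < K) (hu : ContDiff ℝ ∞ u)
    (heq : ∀ z, lap u z = -(K * exp (2 * u z))) (hint : Integrable fun z => exp (2 * u z))
    (c : R2) : hopfIm u c = 0 := by
  obtain ⟨C, hC⟩ := exists_energy_le_of_liouville hK hu heq hint c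
  have h₀ := hu.pd 0
  have h₁ := hu.pd 1
  refine harmonic_eq_zero_of_energy_le (P := fun z => -pd 1 u z) (Q := fun z => -pd 0 u z)
    (N := fun z => -(2 * (pd 0 u z * pd 1 u z))) hu (contDiff_hopfIm hu) h₁.neg h₀.neg
    (contDiff_const.mul (h₀.mul h₁)).neg.continuous (lap_hopfIm hu heq) (fun z => ?_) (fun z => ?_)
    (fun z => ?_) hC
  · rw [pd_neg, pd_neg, hopfIm, pd_comm hu 1 0]
    ring
  · rw [gradSq, neg_sq, neg_sq, add_comm]
  · rw [gradSq, abs_le]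
    constructor <;> nlinarith [sq_nonneg (pd 0 u z + pd 1 u z), sq_nonneg (pd 0 u z - pd 1 u z)]

/-- A smooth function with `∂₀∂₀w = ∂₁∂₁w` and `∂₀∂₁w = 0` is a radial quadratic polynomial. -/
lemma eq_quadratic {w : R2 → ℝ} (hw : ContDiff ℝ ∞ w) (hdiag : pd 0 (pd 0 w) = pd 1 (pd 1 w))
    (hoff : pd 0 (pd 1 w) = fun _ => 0) :
    ∃ a b₀ b₁ : ℝ, (∀ z, w z = a * (z 0 ^ 2 + z 1 ^ 2) + b₀ * z 0 + b₁ * z 1 + w 0) ∧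
      (∀ z, pd 0 w z = 2 * a * z 0 + b₀) ∧ (∀ z, pd 1 w z = 2 * a * z 1 + b₁) ∧
      ∀ z, lap w z = 4 * a := by
  have hoff' : pd 1 (pd 0 w) = fun _ => 0 := by rw [pd_comm hw 1 0, hoff]
  have hx := contDiff_coord 0
  have hy := contDiff_coord 1
  set a := pd 0 (pd 0 w) 0 / 2 with ha
  have hconst : ∀ z, pd 0 (pd 0 w) z = 2 * a := by
    intro z
    rw [eq_const_of_pd_eq_zero ((hw.pd 0).pd 0) (fun i z => ?_) z, ha]
    · ring
    · fin_cases i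
      · change pd 0 (pd 0 (pd 0 w)) z = 0
        rw [hdiag, pd_comm (hw.pd 1) 0 1, hoff, pd_const]
      · change pd 1 (pd 0 (pd 0 w)) z = 0
        rw [pd_comm (hw.pd 0) 1 0, hoff', pd_const]
  have hconst' : ∀ z, pd 1 (pd 1 w) z = 2 * a := fun z => by rw [← hdiag, hconst]
  have hgrad₀ : ∀ z, pd 0 w z = 2 * a * z 0 + pd 0 w 0 := by
    intro z
    have h := eq_const_of_pd_eq_zero ((hw.pd 0).sub (contDiff_const.mul hx : ContDiff ℝ ∞
      fun z : R2 => 2 * a * z 0)) (fun i z => ?_) z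
    · simp only [PiLp.zero_apply, mul_zero, sub_zero] at h
      linarith
    · rw [pd_sub (hw.pd 0) (contDiff_const.mul hx), pd_const_mul hx, pd_coord]
      fin_cases i
      · simp [hconst]
      · simp [hoff']
  have hgrad₁ : ∀ z, pd 1 w z = 2 * a * z 1 + pd 1 w 0 := by
    intro z
    have h := eq_const_of_pd_eq_zero ((hw.pd 1).sub (contDiff_const.mul hy : ContDiff ℝ ∞
      fun z : R2 => 2 * a * z 1)) (fun i z => ?_) z
    · simp only [PiLp.zero_apply, mul_zero, sub_zero] at h
      linarith
    · rw [pd_sub (hw.pd 1) (contDiff_const.mul hy), pd_const_mul hy, pd_coord]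
      fin_cases i
      · simp [hoff]
      · simp [hconst']
  refine ⟨a, pd 0 w 0, pd 1 w 0, fun z => ?_, hgrad₀, hgrad₁, fun z => ?_⟩
  · have hxx : ContDiff ℝ ∞ fun z : R2 => z 0 * z 0 + z 1 * z 1 := (hx.mul hx).add (hy.mul hy)
    have hp₁ : ContDiff ℝ ∞ fun z : R2 => a * (z 0 * z 0 + z 1 * z 1) := contDiff_const.mul hxx
    have hp₂ : ContDiff ℝ ∞ fun z : R2 => pd 0 w 0 * z 0 := contDiff_const.mul hx
    have hp₃ : ContDiff ℝ ∞ fun z : R2 => pd 1 w 0 * z 1 := contDiff_const.mul hy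
    have h := eq_const_of_pd_eq_zero (((hw.sub hp₁).sub hp₂).sub hp₃) (fun i z => ?_) z
    · simp only [PiLp.zero_apply, mul_zero, sub_zero, add_zero] at h
      linarith
    · rw [pd_sub ((hw.sub hp₁).sub hp₂) hp₃, pd_sub (hw.sub hp₁) hp₂, pd_sub hw hp₁,
        pd_const_mul hxx, pd_const_mul hx, pd_const_mul hy, pd_add (hx.mul hx) (hy.mul hy),
        pd_mul hx hx, pd_mul hy hy, pd_coord, pd_coord]
      fin_cases i
      · have := hgrad₀ z
        simp
        linarith
      · have := hgrad₁ z
        simp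
        linarith
  · rw [lap_eq_pd, hconst, hconst']
    ring

/-- Solutions of finite volume are given by the standard bubble. -/
theorem exists_eq_bubble (hK : 0 < K) (hu : ContDiff ℝ ∞ u)
    (heq : ∀ z, lap u z = -(K * exp (2 * u z))) (hint : Integrable fun z => exp (2 * u z)) :
    ∃ lam : ℝ, 0 < lam ∧ ∃ z₀ : R2, ∀ z : R2,
      u z = log (2 * lam / (√K * (1 + lam ^ 2 * ‖z - z₀‖ ^ 2))) := by
  set w : R2 → ℝ := fun z => exp (-u z) with hwdef
  have hw : ContDiff ℝ ∞ w := hu.neg.exp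
  have hpd : ∀ i, pd i w = fun z => -(w z * pd i u z) := by
    intro i
    funext z
    rw [hwdef, pd_exp hu.neg, pd_neg]
    ring
  have hpd₂ : ∀ i j z, pd i (pd j w) z = w z * (pd i u z * pd j u z - pd i (pd j u) z) := by
    intro i j z
    rw [hpd j, pd_neg, pd_mul hw (hu.pd j), hpd i]
    ring
  have hdiag : pd 0 (pd 0 w) = pd 1 (pd 1 w) := by
    funext z
    have h := hopfRe_eq_zero hK hu heq hint z
    rw [hopfRe] at h
    rw [hpd₂, hpd₂]
    linear_combination -w z * h
  have hoff : pd 0 (pd 1 w) = fun _ => 0 := by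
    funext z
    have h := hopfIm_eq_zero hK hu heq hint z
    rw [hopfIm] at h
    rw [hpd₂]
    linear_combination w z / 2 * h
  obtain ⟨a, b₀, b₁, hquad, hg₀, hg₁, hlapw⟩ := eq_quadratic hw hdiag hoff
  have hpos : ∀ z, 0 < w z := fun z => exp_pos _
  have hrel : 4 * a * w 0 - b₀ ^ 2 - b₁ ^ 2 = K := by
    have h₁ := hlapw 0
    have h₂ := heq 0
    have e₀ := hg₀ 0
    have e₁ := hg₁ 0
    rw [hpd] at e₀ e₁
    rw [lap_eq_pd, hpd₂, hpd₂] at h₁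
    rw [lap_eq_pd] at h₂
    simp only [PiLp.zero_apply, mul_zero, zero_add] at e₀ e₁
    have hexp : w 0 ^ 2 * exp (2 * u 0) = 1 := by
      rw [hwdef]
      simp only
      rw [← exp_nat_mul, ← exp_add]
      simp
    rw [← h₁, ← e₀, ← e₁]
    linear_combination -w 0 ^ 2 * h₂ + K * hexp
  have ha : 0 < a := by
    have h : 0 < a * w 0 := by nlinarith [sq_nonneg b₀, sq_nonneg b₁]
    exact (pos_iff_pos_of_mul_pos h).2 (hpos 0)
  have hsK : √K ^ 2 = K := Real.sq_sqrt hK.le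
  have hsK₀ : 0 < √K := Real.sqrt_pos.2 hK
  refine ⟨2 * a / √K, by positivity, !₂[-b₀ / (2 * a), -b₁ / (2 * a)], fun z => ?_⟩
  set ρ := ‖z - !₂[-b₀ / (2 * a), -b₁ / (2 * a)]‖ ^ 2 with hρ
  have hρ' : ρ = (z 0 + b₀ / (2 * a)) ^ 2 + (z 1 + b₁ / (2 * a)) ^ 2 := by
    rw [hρ, ← dist_eq_norm, dist_sq_eq]
    simp
    ring
  have hwz : w z = a * ρ + K / (4 * a) := by
    rw [hquad z, hρ', ← hrel]
    field_simp
    ring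
  have hρ₀ : 0 ≤ ρ := by positivity
  have huz : u z = log (w z)⁻¹ := by
    rw [hwdef, ← exp_neg, neg_neg, log_exp]
  rw [huz, hwz, div_pow, hsK]
  congr 1
  have : 0 < a * ρ + K / (4 * a) := by positivity
  rw [inv_eq_one_div, div_eq_div_iff this.ne' (by positivity)]
  field_simp
  rw [hsK]
  ring

/-- The total curvature of the standard bubble. -/
lemma integral_bubble {K lam : ℝ} (hK : 0 < K) (hlam : 0 < lam) (z₀ : R2) :
    ∫ z : R2, K * exp (2 * log (2 * lam / (√K * (1 + lam ^ 2 * ‖z - z₀‖ ^ 2)))) = 4 * π := by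
  have hsK₀ : 0 < √K := Real.sqrt_pos.2 hK
  have hsK : √K ^ 2 = K := Real.sq_sqrt hK.le
  have hint : ∀ t : ℝ, K * exp (2 * log (2 * lam / (√K * (1 + lam ^ 2 * t ^ 2)))) =
      4 * lam ^ 2 / (1 + lam ^ 2 * t ^ 2) ^ 2 := by
    intro t
    rw [show ∀ x : ℝ, 2 * log x = log (x ^ 2) from fun x => by rw [log_pow]; norm_num,
      exp_log (by positivity), div_pow, mul_pow, mul_pow, hsK]
    field_simp
    norm_num
  simp only [hint]
  rw [integral_sub_right_eq_self (fun z : R2 => 4 * lam ^ 2 / (1 + lam ^ 2 * ‖z‖ ^ 2) ^ 2) z₀,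
    integral_fun_norm_addHaar volume fun t => 4 * lam ^ 2 / (1 + lam ^ 2 * t ^ 2) ^ 2]
  have hderiv : ∀ t : ℝ, HasDerivAt (fun t => -2 * (1 + lam ^ 2 * t ^ 2)⁻¹)
      (t * (4 * lam ^ 2 / (1 + lam ^ 2 * t ^ 2) ^ 2)) t := by
    intro t
    have hne : 1 + lam ^ 2 * t ^ 2 ≠ 0 := by positivity
    have h := ((((hasDerivAt_pow 2 t).const_mul (lam ^ 2)).const_add 1).fun_inv hne).const_mul (-2)
    refine h.congr_deriv ?_
    field_simp
    norm_num
    ring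
  have hlim : Filter.Tendsto (fun t : ℝ => -2 * (1 + lam ^ 2 * t ^ 2)⁻¹) Filter.atTop (𝓝 0) := by
    have h : Filter.Tendsto (fun t : ℝ => 1 + lam ^ 2 * t ^ 2) Filter.atTop Filter.atTop :=
      Filter.tendsto_atTop_add_const_left _ _
        ((Filter.tendsto_pow_atTop two_ne_zero).const_mul_atTop (by positivity))
    simpa using h.inv_tendsto_atTop.const_mul (-2)
  have hval := integral_Ioi_of_hasDerivAt_of_nonneg' (a := 0) (fun t _ => hderiv t)
    (fun t ht => by
      have : 0 < t := ht
      positivity) hlim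
  simp only [finrank_euclideanSpace, Fintype.card_fin, smul_eq_mul, Nat.add_one_sub_one, pow_one,
    hval, nsmul_eq_mul, volume_real_ball (0 : R2) zero_le_one]
  norm_num
  ring

end Liouville

/-- Chen–Li classification: any entire solution of `−Δu = K₀ e^{2u}` on `ℝ²`
with constant `K₀ > 0` and `∫ e^{2u} dz < ∞` has total curvature
`∫ K₀ e^{2u} dz = 4π` and comes from the stereographic projection:
`u(z) = log (2λ / (√K₀ (1 + λ² |z − z₀|²)))`. -/
theorem stmt_18 (u : R2 → ℝ) (K₀ : ℝ) (hK : 0 < K₀)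
    (hsm : ContDiff ℝ (⊤ : ℕ∞) u)
    (heq : ∀ z, -lap u z = K₀ * Real.exp (2 * u z))
    (hint : Integrable (fun z => Real.exp (2 * u z))) :
    (∫ z, K₀ * Real.exp (2 * u z)) = 4 * π ∧
    ∃ lam : ℝ, 0 < lam ∧ ∃ z₀ : R2, ∀ z : R2,
      u z = Real.log (2 * lam / (Real.sqrt K₀ * (1 + lam ^ 2 * ‖z - z₀‖ ^ 2))) := by
  have hbubble := exists_eq_bubble hK hsm (fun z => by linarith [heq z]) hint
  refine ⟨?_, hbubble⟩
  obtain ⟨lam, hlam, z₀, hz⟩ := hbubble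
  simp only [hz]
  exact integral_bubble hK hlam z₀
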